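/- (Main theorem, case 2) Assume the data is of Heisenberg type. Let p > Q, let α be a real number with −α ≥ (p−Q)/(p−1), and let ρ : G → ℝ be continuous, nonnegative, with compact support. Define F(g) = ∫_G ρ(g') N(g'⁻¹ · g)^{−α} dg'. Then F is twice continuously differentiable on G, and for every g ∈ G one has |XF(g)|² 𝓛F(g) + (p−2) 𝓛_∞F(g) ≥ 0; that is, F is p-subharmonic. -/

import Mathlib

open scoped RealInnerProductSpace
open MeasureTheory

noncomputable section

variable {V₁ V₂ : Type*} [NormedAddCommGroup V₁] [InnerProductSpace ℝ V₁]
  [NormedAddCommGroup V₂] [InnerProductSpace ℝ V₂]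

/-- The horizontal derivative of `f : V₁ × V₂ → ℝ` at `g = (z,t)` in the horizontal
direction `v ∈ V₁`, namely `Df(g)(v, ½[z,v])`. -/
def Xd (b : V₁ →ₗ[ℝ] V₁ →ₗ[ℝ] V₂) (v : V₁) (f : V₁ × V₂ → ℝ) (g : V₁ × V₂) : ℝ :=
  fderiv ℝ f g (v, (2⁻¹ : ℝ) • b g.1 v)

/-- The horizontal gradient: the unique vector of `V₁` representing the linear functional
`v ↦ X_v f (g)` via the inner product of `V₁`. -/
def Xgrad [FiniteDimensional ℝ V₁] [FiniteDimensional ℝ V₂]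
    (b : V₁ →ₗ[ℝ] V₁ →ₗ[ℝ] V₂) (f : V₁ × V₂ → ℝ) (g : V₁ × V₂) : V₁ :=
  (InnerProductSpace.toDual ℝ V₁).symm
    (LinearMap.toContinuousLinearMap
      ((fderiv ℝ f g).toLinearMap.comp
        (LinearMap.prod LinearMap.id ((2⁻¹ : ℝ) • b g.1))))

/-- The symmetrized second horizontal derivative `f_{,uv} = ½(X_u X_v f + X_v X_u f)`. -/
def X2sym (b : V₁ →ₗ[ℝ] V₁ →ₗ[ℝ] V₂) (u v : V₁) (f : V₁ × V₂ → ℝ) (g : V₁ × V₂) : ℝ :=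
  (Xd b u (Xd b v f) g + Xd b v (Xd b u f) g) / 2

/-- The horizontal (sub-)Laplacian `𝓛 f = Σᵢ X_{eᵢ} X_{eᵢ} f`. -/
def hLap [FiniteDimensional ℝ V₁] (b : V₁ →ₗ[ℝ] V₁ →ₗ[ℝ] V₂) (f : V₁ × V₂ → ℝ)
    (g : V₁ × V₂) : ℝ :=
  ∑ i, Xd b (stdOrthonormalBasis ℝ V₁ i) (Xd b (stdOrthonormalBasis ℝ V₁ i) f) g

/-- The horizontal ∞-Laplacian `𝓛_∞ f = Σ_{i,j} f_{,eᵢeⱼ} X_{eᵢ}f X_{eⱼ}f`. -/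
def hInfLap [FiniteDimensional ℝ V₁] (b : V₁ →ₗ[ℝ] V₁ →ₗ[ℝ] V₂) (f : V₁ × V₂ → ℝ)
    (g : V₁ × V₂) : ℝ :=
  ∑ i, ∑ j, X2sym b (stdOrthonormalBasis ℝ V₁ i) (stdOrthonormalBasis ℝ V₁ j) f g *
    Xd b (stdOrthonormalBasis ℝ V₁ i) f g * Xd b (stdOrthonormalBasis ℝ V₁ j) f g

/-- `ψ(z,t) = |z|²`. -/
def psiF (g : V₁ × V₂) : ℝ := ‖g.1‖ ^ 2

/-- `χ(z,t) = |t|²`. -/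
def chiF (g : V₁ × V₂) : ℝ := ‖g.2‖ ^ 2

/-- `a(z,t) = ψ² + 16χ = |z|⁴ + 16|t|²`. -/
def aF (g : V₁ × V₂) : ℝ := psiF g ^ 2 + 16 * chiF g

/-- The Folland–Kaplan gauge `N = a^{1/4}`. -/
def Ng (g : V₁ × V₂) : ℝ := aF g ^ ((1 : ℝ) / 4)

/-- `A(z,t) = |z|² z + 4 J(t) z`. -/
def Ag (J : V₂ → V₁ →ₗ[ℝ] V₁) (g : V₁ × V₂) : V₁ :=
  ‖g.1‖ ^ 2 • g.1 + (4 : ℝ) • J g.2 g.1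

/-- The group law `(z,t)·(z',t') = (z+z', t+t'+½[z,z'])`. -/
def gmul (b : V₁ →ₗ[ℝ] V₁ →ₗ[ℝ] V₂) (g h : V₁ × V₂) : V₁ × V₂ :=
  (g.1 + h.1, g.2 + h.2 + (2⁻¹ : ℝ) • b g.1 h.1)

/-- The group inverse `(z,t)⁻¹ = (−z,−t)`. -/
def ginv (g : V₁ × V₂) : V₁ × V₂ := (-g.1, -g.2)

end

section Mach
open Filter Topology Metric
set_option linter.unusedSectionVars false

variable {V₁ V₂ : Type*} [NormedAddCommGroup V₁] [InnerProductSpace ℝ V₁]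
  [FiniteDimensional ℝ V₁] [NormedAddCommGroup V₂] [InnerProductSpace ℝ V₂]
  [FiniteDimensional ℝ V₂]

/-- continuous version of the bracket -/
noncomputable def bcl (b : V₁ →ₗ[ℝ] V₁ →ₗ[ℝ] V₂) : V₁ →L[ℝ] V₁ →L[ℝ] V₂ :=
  LinearMap.toContinuousLinearMap
    ((LinearMap.toContinuousLinearMap : (V₁ →ₗ[ℝ] V₂) ≃ₗ[ℝ] (V₁ →L[ℝ] V₂)).toLinearMap ∘ₗ b)

lemma bcl_apply (b : V₁ →ₗ[ℝ] V₁ →ₗ[ℝ] V₂) (u v : V₁) : bcl b u v = b u v := rfl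

/-- linear part of `g ↦ g'⁻¹ g` -/
noncomputable def ell (b : V₁ →ₗ[ℝ] V₁ →ₗ[ℝ] V₂) (g' : V₁ × V₂) :
    (V₁ × V₂) →L[ℝ] (V₁ × V₂) :=
  ContinuousLinearMap.id ℝ _ + (ContinuousLinearMap.inr ℝ V₁ V₂).comp
    ((-(2⁻¹ : ℝ) • bcl b g'.1).comp (ContinuousLinearMap.fst ℝ V₁ V₂))

lemma ell_apply (b : V₁ →ₗ[ℝ] V₁ →ₗ[ℝ] V₂) (g' g : V₁ × V₂) :
    ell b g' g = (g.1, g.2 - (2⁻¹ : ℝ) • b g'.1 g.1) := by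
  ext <;> simp [ell, bcl_apply, sub_eq_add_neg]

lemma ell_cont (b : V₁ →ₗ[ℝ] V₁ →ₗ[ℝ] V₂) : Continuous (ell b) := by
  unfold ell
  fun_prop

/-- `g'⁻¹ g` -/
noncomputable def gL (b : V₁ →ₗ[ℝ] V₁ →ₗ[ℝ] V₂) (g' g : V₁ × V₂) : V₁ × V₂ :=
  gmul b (ginv g') g

lemma gL_eq (b : V₁ →ₗ[ℝ] V₁ →ₗ[ℝ] V₂) (g' g : V₁ × V₂) :
    gL b g' g = ell b g' g - g' := by
  rw [ell_apply]
  ext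
  · simp [gL, gmul, ginv]; abel
  · simp [gL, gmul, ginv]; abel

lemma gL_hasFDerivAt (b : V₁ →ₗ[ℝ] V₁ →ₗ[ℝ] V₂) (g' g : V₁ × V₂) :
    HasFDerivAt (gL b g') (ell b g') g := by
  have : gL b g' = fun g => ell b g' g - g' := funext (gL_eq b g')
  rw [this]
  exact (ell b g').hasFDerivAt.sub_const g'

lemma gL_cont (b : V₁ →ₗ[ℝ] V₁ →ₗ[ℝ] V₂) :
    Continuous (fun q : (V₁ × V₂) × (V₁ × V₂) => gL b q.1 q.2) := by
  simp_rw [gL_eq]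
  have := ell_cont b
  fun_prop

variable [MeasurableSpace V₁] [BorelSpace V₁] [MeasurableSpace V₂] [BorelSpace V₂]

lemma gL_mp (b : V₁ →ₗ[ℝ] V₁ →ₗ[ℝ] V₂) (g : V₁ × V₂) :
    MeasurePreserving (fun g' => gL b g' g) := by
  have h : (fun g' => gL b g' g) = fun q : V₁ × V₂ =>
      (g.1 - q.1, (g.2 - (2⁻¹ : ℝ) • b q.1 g.1) - q.2) := by
    funext q
    rw [gL_eq, ell_apply]
    ext <;> simp
  rw [h]
  have hc : Continuous (fun q : V₁ => b q g.1) := by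
    have : (fun q : V₁ => b q g.1) = fun q => bcl b q g.1 := rfl
    rw [this]; fun_prop
  refine MeasurePreserving.skew_product (f := fun q : V₁ => g.1 - q)
    (g := fun (q : V₁) (t : V₂) => (g.2 - (2⁻¹ : ℝ) • b q g.1) - t)
    (Measure.measurePreserving_sub_left volume g.1) ?_ ?_
  · apply Continuous.measurable
    unfold Function.uncurry
    fun_prop
  · exact ae_of_all _ fun q => (Measure.measurePreserving_sub_left volume _).map_eq

lemma gL_emb (b : V₁ →ₗ[ℝ] V₁ →ₗ[ℝ] V₂) (g : V₁ × V₂) :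
    MeasurableEmbedding (fun g' => gL b g' g) := by
  apply Continuous.measurableEmbedding
  · exact (gL_cont b).comp (by fun_prop : Continuous fun g' => (g', g))
  · intro x y h
    simp only [gL_eq, ell_apply] at h
    have h1 := congrArg Prod.fst h
    have h2 := congrArg Prod.snd h
    simp at h1 h2
    rw [h1] at h2
    ext
    · exact h1
    · simpa using h2

end Mach

section Gen
open Filter Topology Metric
set_option linter.unusedSectionVars false

variable {E : Type*} [NormedAddCommGroup E] [NormedSpace ℝ E] [FiniteDimensional ℝ E]
  [MeasureSpace E] [BorelSpace E] [IsFiniteMeasureOnCompacts (volume : Measure E)]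

/-- abstract group data -/
structure Dat (E : Type*) [NormedAddCommGroup E] [NormedSpace ℝ E] [MeasureSpace E] where
  L : E → E → E
  l : E → E →L[ℝ] E
  Lcont : Continuous (fun q : E × E => L q.1 q.2)
  lcont : Continuous l
  der : ∀ g' g, HasFDerivAt (L g') (l g') g
  mp : ∀ g, MeasurePreserving (fun g' => L g' g)
  emb : ∀ g, MeasurableEmbedding (fun g' => L g' g)

/-- the convolution -/
noncomputable def cv {W W' : Type*} [NormedAddCommGroup W] [NormedSpace ℝ W]
    [NormedAddCommGroup W'] [NormedSpace ℝ W'] (b : Dat E)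
    (T : E → W → W') (K : E → W) (g : E) : W' :=
  ∫ g', T g' (K (b.L g' g))

/-- admissible multipliers -/
structure Good {W W' : Type*} [NormedAddCommGroup W]
    [NormedAddCommGroup W'] (T : E → W → W') : Prop where
  cont : Continuous (fun q : E × W => T q.1 q.2)
  sub : ∀ g w w', T g (w - w') = T g w - T g w'
  bd : ∃ M : ℝ, 0 ≤ M ∧ ∀ g w, ‖T g w‖ ≤ M * ‖w‖
  supp : ∃ R : ℝ, ∀ g, g ∉ closedBall (0 : E) R → ∀ w, T g w = 0

section
variable {W W' : Type*} [NormedAddCommGroup W] [NormedSpace ℝ W]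
    [NormedAddCommGroup W'] [NormedSpace ℝ W'] (b : Dat E)
    {T : E → W → W'}

lemma supp_bd (hT : Good T) (r : ℝ) :
    ∃ M R R', 0 ≤ M ∧ (∀ g' w, ‖T g' w‖ ≤ M * ‖w‖) ∧
      (∀ g, g ∉ closedBall (0 : E) R' → ∀ w, T g w = 0) ∧
      ∀ g ∈ closedBall (0 : E) r, ∀ g',
      g' ∈ closedBall (0 : E) R' → b.L g' g ∈ closedBall (0 : E) R := by
  obtain ⟨M, hM0, hM⟩ := hT.bd
  obtain ⟨R', hR'⟩ := hT.supp
  have hc : IsCompact ((fun q : E × E => b.L q.1 q.2) ''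
      (closedBall (0 : E) R' ×ˢ closedBall (0 : E) r)) :=
    ((isCompact_closedBall _ _).prod (isCompact_closedBall _ _)).image (b.Lcont)
  obtain ⟨R, hR⟩ := hc.isBounded.subset_closedBall 0
  refine ⟨M, R, R', hM0, hM, hR', ?_⟩
  intro g hg g' hg'
  exact hR ⟨(g', g), ⟨hg', hg⟩, rfl⟩

/-- local integrability on balls -/
def LI (K : E → W) : Prop := ∀ R, IntegrableOn K (closedBall 0 R)

lemma cv_integrable (hT : Good T) {K : E → W}
    (hK : LI K) (g : E) : Integrable (fun g' => T g' (K (b.L g' g))) := by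
  obtain ⟨M, R, R', hM0, hM, hs, hR⟩ := supp_bd b hT ‖g‖
  have hR' := hR g (by simp)
  have h1 : IntegrableOn (fun g' => K (b.L g' g)) ((fun g' => b.L g' g) ⁻¹' closedBall 0 R) :=
    ((b.mp g).integrableOn_comp_preimage (b.emb g)).2 (hK R)
  have h2 : IntegrableOn (fun g' => K (b.L g' g)) (closedBall 0 R') :=
    h1.mono_set (fun g' hg' => hR' g' hg')
  have h3 : IntegrableOn (fun g' => T g' (K (b.L g' g))) (closedBall 0 R') := by
    refine Integrable.mono' (h2.norm.const_mul M) ?_ ?_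
    · exact hT.cont.comp_aestronglyMeasurable
        (continuous_id.aestronglyMeasurable.prodMk h2.aestronglyMeasurable)
    · exact ae_of_all _ fun g' => hM _ _
  refine (integrableOn_iff_integrable_of_support_subset ?_).1 h3
  intro x hx
  by_contra hn
  exact hx (hs x hn _)

lemma cv_sub_le (hT : Good T) (r : ℝ) :
    ∃ M R, 0 ≤ M ∧ ∀ K K' : E → W, LI K → LI K' → ∀ g ∈ closedBall (0 : E) r,
      ‖cv b T K g - cv b T K' g‖ ≤ M * ∫ h in closedBall 0 R, ‖K h - K' h‖ := by
  obtain ⟨M, R, R', hM0, hM, hs, hR⟩ := supp_bd b hT r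
  refine ⟨M, R, hM0, fun K K' hK hK' g hg => ?_⟩
  have hR' := hR g hg
  unfold cv
  rw [← integral_sub (cv_integrable b hT hK g) (cv_integrable b hT hK' g)]
  simp_rw [← hT.sub]
  have h1 : IntegrableOn (fun g' => ‖K (b.L g' g) - K' (b.L g' g)‖)
      ((fun g' => b.L g' g) ⁻¹' closedBall 0 R) :=
    ((b.mp g).integrableOn_comp_preimage (b.emb g)
      (f := fun h => ‖K h - K' h‖)).2 ((hK R).sub (hK' R)).norm
  have hms : MeasurableSet ((fun g' => b.L g' g) ⁻¹' closedBall 0 R) :=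
    (b.mp g).measurable isClosed_closedBall.measurableSet
  calc _ ≤ ∫ g', ((fun g' => b.L g' g) ⁻¹' closedBall 0 R).indicator
        (fun g' => M * ‖K (b.L g' g) - K' (b.L g' g)‖) g' := by
        refine norm_integral_le_of_norm_le ?_ ?_
        · exact (integrable_indicator_iff hms).2 (h1.const_mul M)
        · refine ae_of_all _ fun g' => ?_
          by_cases hg' : g' ∈ closedBall 0 R'
          · rw [Set.indicator_of_mem (show g' ∈ _ from hR' g' hg')]
            exact hM _ _
          · rw [hs g' hg', norm_zero]
            exact Set.indicator_nonneg (fun _ _ => by positivity) _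
    _ = M * ∫ h in closedBall 0 R, ‖K h - K' h‖ := by
        rw [integral_indicator hms, integral_const_mul,
          (b.mp g).setIntegral_preimage_emb (b.emb g) (fun h => ‖K h - K' h‖)]

/-- L¹_loc approximation by continuous functions -/
structure L1c (Kn : ℕ → E → W) (K : E → W) : Prop where
  cont : ∀ n, Continuous (Kn n)
  li : LI K
  tend : ∀ R, Tendsto (fun n => ∫ h in closedBall (0 : E) R, ‖Kn n h - K h‖) atTop (𝓝 0)

lemma LI_cont {K : E → W} (hK : Continuous K) : LI K := fun _ =>
  hK.continuousOn.integrableOn_compact (isCompact_closedBall _ _)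

lemma cv_tlu (hT : Good T) {Kn : ℕ → E → W}
    {K : E → W} (h : L1c Kn K) :
    TendstoLocallyUniformly (fun n => cv b T (Kn n)) (cv b T K) atTop := by
  rw [Metric.tendstoLocallyUniformly_iff]
  intro ε hε x
  obtain ⟨M, R, hM0, hM⟩ := cv_sub_le b hT (‖x‖ + 1)
  refine ⟨closedBall 0 (‖x‖ + 1), ?_, ?_⟩
  · exact mem_of_superset (ball_mem_nhds x one_pos) (fun y hy => by
      rw [mem_ball, dist_eq_norm] at hy
      rw [mem_closedBall, dist_zero_right]
      have := norm_sub_norm_le y x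
      linarith)
  · have h1 := (h.tend R).const_mul M
    rw [mul_zero] at h1
    filter_upwards [h1.eventually (gt_mem_nhds hε)] with n hn y hy
    rw [dist_comm, dist_eq_norm]
    exact (hM _ _ (LI_cont (h.cont n)) h.li y hy).trans_lt hn

lemma cv_cont0 (hT : Good T) {K : E → W} (hK : Continuous K) : Continuous (cv b T K) := by
  have hgc := b.Lcont
  have hTc := hT.cont
  obtain ⟨M, R, R', hM0, hM, hs, hR⟩ := supp_bd b hT 0
  unfold cv
  have : ∀ g, ∫ g', T g' (K (b.L g' g)) = ∫ g' in closedBall 0 R', T g' (K (b.L g' g)) := by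
    intro g
    rw [setIntegral_eq_integral_of_forall_compl_eq_zero]
    intro g' hg'
    exact hs g' hg' _
  simp_rw [this]
  refine continuous_parametric_integral_of_continuous (μ := volume)
    (f := fun g g' => T g' (K (b.L g' g))) ?_ (isCompact_closedBall _ _)
  exact hTc.comp (continuous_snd.prodMk (hK.comp (hgc.comp (continuous_snd.prodMk continuous_fst))))

lemma cv_cont (hT : Good T) {Kn : ℕ → E → W}
    {K : E → W} (h : L1c Kn K) :
    Continuous (cv b T K) :=
  (cv_tlu b hT h).continuous (Frequently.of_forall fun n => cv_cont0 b hT (h.cont n))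

lemma cv_smooth (hT : Good T) {T' : E → (E →L[ℝ] W) → (E →L[ℝ] W')}
    (hT' : Good T') {K : E → W}
    {K' : E → E →L[ℝ] W} (hd : ∀ h, HasFDerivAt K (K' h) h) (hc : Continuous K')
    (hTT : ∀ g' x, HasFDerivAt (fun x => T g' (K (b.L g' x))) (T' g' (K' (b.L g' x))) x)
    (g : E) : HasFDerivAt (cv b T K) (cv b T' K' g) g := by
  have hKc : Continuous K := continuous_iff_continuousAt.2 fun h => (hd h).continuousAt
  have hgc := b.Lcont
  have hTc := hT.cont
  have hTc' := hT'.cont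
  obtain ⟨R, hR⟩ := hT'.supp
  have hT2 : Continuous (fun q : E × E => T' q.1 (K' (b.L q.1 q.2))) :=
    hTc'.comp (continuous_fst.prodMk (hc.comp hgc))
  obtain ⟨C, hC⟩ := ((isCompact_closedBall (0 : E) R).prod
    (isCompact_closedBall g 1)).exists_bound_of_continuousOn hT2.continuousOn
  unfold cv
  refine hasFDerivAt_integral_of_dominated_of_fderiv_le (s := closedBall g 1)
    (F := fun x g' => T g' (K (b.L g' x))) (F' := fun x g' => T' g' (K' (b.L g' x)))
    (bound := (closedBall (0 : E) R).indicator (fun _ => C))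
    (closedBall_mem_nhds g one_pos) ?_ (cv_integrable b hT (LI_cont hKc) g) ?_ ?_ ?_ ?_
  · refine Eventually.of_forall fun x => ?_
    apply Continuous.aestronglyMeasurable
    exact hTc.comp (continuous_id.prodMk (hKc.comp (hgc.comp (continuous_id.prodMk
      continuous_const))))
  · have : ProperSpace E := FiniteDimensional.proper ℝ E
    have : SecondCountableTopology E := secondCountable_of_proper
    have : SecondCountableTopologyEither E (E →L[ℝ] W') := ⟨Or.inl this⟩
    apply Continuous.aestronglyMeasurable
    exact hT2.comp (continuous_id.prodMk continuous_const)
  · refine ae_of_all _ fun g' x hx => ?_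
    by_cases hg' : g' ∈ closedBall (0 : E) R
    · rw [Set.indicator_of_mem hg']
      exact hC (g', x) ⟨hg', hx⟩
    · rw [Set.indicator_of_notMem hg', hR g' hg', norm_zero]
  · rw [integrable_indicator_iff isClosed_closedBall.measurableSet]
    exact continuousOn_const.integrableOn_compact (isCompact_closedBall _ _)
  · exact ae_of_all _ fun g' x hx => hTT g' x

lemma cv_sing (hT : Good T) {T' : E → (E →L[ℝ] W) → (E →L[ℝ] W')}
    (hT' : Good T') {Kn : ℕ → E → W}
    {K : E → W} (h : L1c Kn K) {Kn' : ℕ → E → E →L[ℝ] W}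
    {K' : E → E →L[ℝ] W} (h' : L1c Kn' K')
    (hd : ∀ n h, HasFDerivAt (Kn n) (Kn' n h) h)
    (hTT : ∀ n g' x, HasFDerivAt (fun x => T g' (Kn n (b.L g' x)))
      (T' g' (Kn' n (b.L g' x))) x) (g : E) :
    HasFDerivAt (cv b T K) (cv b T' K' g) g := by
  refine hasFDerivAt_of_tendstoLocallyUniformlyOn (l := atTop) isOpen_univ
    (f := fun n => cv b T (Kn n)) (f' := fun n => cv b T' (Kn' n))
    (tendstoLocallyUniformlyOn_univ.2 (cv_tlu b hT' h')) ?_ ?_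
    (Set.mem_univ g)
  · intro n x _
    exact cv_smooth b hT hT' (hd n) (h'.cont n) (hTT n) x
  · intro x _
    exact (tendstoLocallyUniformlyOn_univ.2 (cv_tlu b hT h)).tendsto_at (Set.mem_univ x)
end

section
variable (b : Dat E) (ρ : E → ℝ)

/-- multiplier of order 0 -/
def T0 (g' : E) (w : ℝ) : ℝ := ρ g' * w

/-- multiplier of order 1 -/
noncomputable def T1 (g' : E) (A : E →L[ℝ] ℝ) : E →L[ℝ] ℝ :=
  ρ g' • A.comp (b.l g')

/-- multiplier of order 2 -/
noncomputable def T2 (g' : E) (A : E →L[ℝ] E →L[ℝ] ℝ) :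
    E →L[ℝ] E →L[ℝ] ℝ :=
  ρ g' • (((ContinuousLinearMap.compL ℝ E E ℝ).flip (b.l g')).comp
    A).comp (b.l g')

lemma T2_apply (g' : E) (A : E →L[ℝ] E →L[ℝ] ℝ) (x y : E) :
    T2 b ρ g' A x y = ρ g' * A (b.l g' x) (b.l g' y) := by
  simp [T2]

variable {ρ} (hρc : Continuous ρ) (hρs : HasCompactSupport ρ)
include hρc hρs

lemma rho_bd (f : E → ℝ) (hf : Continuous f) : ∃ M : ℝ, 0 ≤ M ∧ ∀ g, ‖ρ g‖ * f g ≤ M := by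
  obtain ⟨M, hM⟩ := (hρc.mul hf).bounded_above_of_compact_support hρs.mul_right
  refine ⟨M, (norm_nonneg _).trans (hM 0), fun g => ?_⟩
  refine le_trans ?_ (hM g)
  change _ ≤ ‖ρ g * f g‖
  rw [norm_mul]
  gcongr
  exact le_abs_self _

lemma rho_supp : ∃ R : ℝ, ∀ g, g ∉ closedBall (0 : E) R → ρ g = 0 := by
  obtain ⟨R, hR⟩ := hρs.isCompact.isBounded.subset_closedBall 0
  exact ⟨R, fun g hg => image_eq_zero_of_notMem_tsupport fun h => hg (hR h)⟩

lemma T0_good : Good (T0 ρ) where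
  cont := by unfold T0; fun_prop
  sub g w w' := by simp [T0, mul_sub]
  bd := by
    obtain ⟨M, h0, hM⟩ := rho_bd hρc hρs (fun _ => 1) continuous_const
    exact ⟨M, h0, fun g w => by
      rw [T0, norm_mul]; gcongr; simpa using hM g⟩
  supp := by
    obtain ⟨R, hR⟩ := rho_supp hρc hρs
    exact ⟨R, fun g hg w => by simp [T0, hR g hg]⟩

lemma T1_good : Good (T1 b ρ) where
  cont := by
    have := b.lcont
    unfold T1; fun_prop
  sub g w w' := by simp [T1, smul_sub]
  bd := by
    obtain ⟨M, h0, hM⟩ := rho_bd hρc hρs (fun g => ‖b.l g‖) (b.lcont).norm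
    refine ⟨M, h0, fun g w => ?_⟩
    rw [T1, norm_smul]
    calc _ ≤ ‖ρ g‖ * (‖w‖ * ‖b.l g‖) := by gcongr; exact w.opNorm_comp_le _
      _ = (‖ρ g‖ * ‖b.l g‖) * ‖w‖ := by ring
      _ ≤ _ := by gcongr; exact hM g
  supp := by
    obtain ⟨R, hR⟩ := rho_supp hρc hρs
    exact ⟨R, fun g hg w => by simp [T1, hR g hg]⟩

lemma T2_good : Good (T2 b ρ) where
  cont := by
    have := b.lcont
    unfold T2; fun_prop
  sub g w w' := by
    refine ContinuousLinearMap.ext fun x => ContinuousLinearMap.ext fun y => ?_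
    simp [T2_apply, mul_sub]
  bd := by
    obtain ⟨M, h0, hM⟩ := rho_bd hρc hρs (fun g => ‖b.l g‖ * ‖b.l g‖)
      ((b.lcont).norm.mul (b.lcont).norm)
    refine ⟨M, h0, fun g w => ?_⟩
    refine ContinuousLinearMap.opNorm_le_bound₂ _ (by positivity) fun x y => ?_
    rw [T2_apply, norm_mul]
    calc _ ≤ ‖ρ g‖ * (‖w‖ * (‖b.l g‖ * ‖x‖) * (‖b.l g‖ * ‖y‖)) := by
            gcongr
            refine (w.le_opNorm₂ _ _).trans ?_
            gcongr
            · exact (b.l g).le_opNorm _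
            · exact (b.l g).le_opNorm _
      _ = (‖ρ g‖ * (‖b.l g‖ * ‖b.l g‖)) * ‖w‖ * ‖x‖ * ‖y‖ := by ring
      _ ≤ _ := by gcongr; exact hM g
  supp := by
    obtain ⟨R, hR⟩ := rho_supp hρc hρs
    exact ⟨R, fun g hg w => by simp [T2, hR g hg]⟩

lemma T0_der {K : E → ℝ} {K' : E → E →L[ℝ] ℝ}
    (hd : ∀ h, HasFDerivAt K (K' h) h) (g' x : E) :
    HasFDerivAt (fun x => T0 ρ g' (K (b.L g' x))) (T1 b ρ g' (K' (b.L g' x))) x :=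
  (((hd _).comp x (b.der g' x)).const_mul (ρ g'))

lemma T1_der {K : E → E →L[ℝ] ℝ} {K' : E → E →L[ℝ] E →L[ℝ] ℝ}
    (hd : ∀ h, HasFDerivAt K (K' h) h) (g' x : E) :
    HasFDerivAt (fun x => T1 b ρ g' (K (b.L g' x))) (T2 b ρ g' (K' (b.L g' x))) x := by
  have h1 := ((hd _).comp x (b.der g' x))
  have h2 := (((ContinuousLinearMap.compL ℝ E E ℝ).flip
    (b.l g')).hasFDerivAt.comp x h1).const_smul (ρ g')
  exact h2

/-- Main regularity statement -/
lemma cv_main {K0n : ℕ → E → ℝ} {K0 : E → ℝ}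
    {K1n : ℕ → E → E →L[ℝ] ℝ} {K1 : E → E →L[ℝ] ℝ}
    {K2n : ℕ → E → E →L[ℝ] E →L[ℝ] ℝ}
    {K2 : E → E →L[ℝ] E →L[ℝ] ℝ}
    (h0 : L1c K0n K0) (h1 : L1c K1n K1) (h2 : L1c K2n K2)
    (hd0 : ∀ n h, HasFDerivAt (K0n n) (K1n n h) h)
    (hd1 : ∀ n h, HasFDerivAt (K1n n) (K2n n h) h) :
    (∀ g, HasFDerivAt (cv b (T0 ρ) K0) (cv b (T1 b ρ) K1 g) g) ∧
    (∀ g, HasFDerivAt (cv b (T1 b ρ) K1) (cv b (T2 b ρ) K2 g) g) ∧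
    Continuous (cv b (T2 b ρ) K2) ∧
    ∀ g x y, Integrable (fun g' => ρ g' * K2 (b.L g' g) (b.l g' x) (b.l g' y)) ∧
      cv b (T2 b ρ) K2 g x y = ∫ g', ρ g' * K2 (b.L g' g) (b.l g' x) (b.l g' y) := by
  refine ⟨cv_sing b (T0_good hρc hρs) (T1_good b hρc hρs) h0 h1 hd0
    (fun n => T0_der b hρc hρs (hd0 n)), cv_sing b (T1_good b hρc hρs) (T2_good b hρc hρs) h1 h2 hd1
    (fun n => T1_der b hρc hρs (hd1 n)), cv_cont b (T2_good b hρc hρs) h2, fun g x y => ?_⟩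
  have hi := cv_integrable b (T2_good b hρc hρs) h2.li g
  have hix := hi.apply_continuousLinearMap x
  simp_rw [← T2_apply]
  refine ⟨hix.apply_continuousLinearMap y, ?_⟩
  unfold cv
  rw [ContinuousLinearMap.integral_apply hi, ContinuousLinearMap.integral_apply hix]
end
end Gen

section Ker
open Filter Topology Metric
set_option maxSynthPendingDepth 3
set_option linter.unusedSectionVars false

variable {E : Type*} [NormedAddCommGroup E] [NormedSpace ℝ E] [FiniteDimensional ℝ E]
  [MeasureSpace E] [BorelSpace E] [IsFiniteMeasureOnCompacts (volume : Measure E)]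

lemma L1c_of_dom {W : Type*} [NormedAddCommGroup W] [NormedSpace ℝ W]
    {Kn : ℕ → E → W} {K : E → W} (hc : ∀ n, Continuous (Kn n))
    (hlim : ∀ᵐ h : E, Tendsto (fun n => Kn n h) atTop (𝓝 (K h)))
    (hB : ∀ R, ∃ B : E → ℝ, IntegrableOn B (closedBall 0 R) ∧
      ∀ n, ∀ᵐ h ∂(volume.restrict (closedBall (0 : E) R)), ‖Kn n h‖ ≤ B h) : L1c Kn K := by
  have : ProperSpace E := FiniteDimensional.proper ℝ E
  have : SecondCountableTopology E := secondCountable_of_proper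
  have : SecondCountableTopologyEither E W := ⟨Or.inl this⟩
  have hli : LI K := by
    intro R
    obtain ⟨B, hBi, hBb⟩ := hB R
    refine Integrable.mono' hBi ?_ ?_
    · exact (aestronglyMeasurable_of_tendsto_ae atTop
        (fun n => (hc n).aestronglyMeasurable) hlim).restrict
    · filter_upwards [ae_all_iff.2 hBb, ae_restrict_of_ae hlim] with h h1 h2
      exact le_of_tendsto h2.norm (Eventually.of_forall h1)
  refine ⟨hc, hli, ?_⟩
  intro R
  obtain ⟨B, hBi, hBb⟩ := hB R
  have h0 : (0 : ℝ) = ∫ h in closedBall (0 : E) R, (0 : ℝ) := by simp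
  rw [h0]
  refine tendsto_integral_of_dominated_convergence (fun h => B h + ‖K h‖) ?_
    (hBi.add (hli R).norm) ?_ ?_
  · intro n
    exact ((hc n).aestronglyMeasurable.sub (hli R).aestronglyMeasurable).norm
  · intro n
    filter_upwards [hBb n] with h h1
    rw [norm_norm]
    exact (norm_sub_le _ _).trans (by gcongr)
  · filter_upwards [ae_restrict_of_ae hlim] with h h2
    have := (h2.sub_const (K h)).norm
    simpa using this

variable (a : E → ℝ) (s : ℝ)

/-- regularised kernel -/
noncomputable def K0 (ε : ℝ) (h : E) : ℝ := (a h + ε) ^ s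

/-- its derivative -/
noncomputable def K1 (ε : ℝ) (h : E) : E →L[ℝ] ℝ := (s * (a h + ε) ^ (s - 1)) • fderiv ℝ a h

/-- its second derivative -/
noncomputable def K2 (ε : ℝ) (h : E) : E →L[ℝ] E →L[ℝ] ℝ :=
  (s * (a h + ε) ^ (s - 1)) • fderiv ℝ (fderiv ℝ a) h +
    (s * (s - 1) * (a h + ε) ^ (s - 2)) • (fderiv ℝ a h).smulRight (fderiv ℝ a h)

variable {a} (ha : ContDiff ℝ 2 a) (ha0 : ∀ h, 0 ≤ a h)
include ha ha0

lemma Da_cd : ContDiff ℝ 1 (fderiv ℝ a) := ha.fderiv_right (by norm_num)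

lemma Da_c : Continuous (fderiv ℝ a) := (Da_cd ha ha0).continuous

lemma D2a_c : Continuous (fderiv ℝ (fderiv ℝ a)) :=
  ((Da_cd ha ha0).fderiv_right (m := 0) (by norm_num)).continuous

lemma rp_c {ε : ℝ} (hε : 0 < ε) (r : ℝ) : Continuous fun h => (a h + ε) ^ r :=
  (ha.continuous.add continuous_const).rpow_const fun h => Or.inl (by have := ha0 h; change a h + ε ≠ 0; positivity)

lemma rp_d {ε : ℝ} (hε : 0 < ε) (r : ℝ) (h : E) :
    HasFDerivAt (fun h => (a h + ε) ^ r) ((r * (a h + ε) ^ (r - 1)) • fderiv ℝ a h) h := by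
  have h1 : HasFDerivAt a (fderiv ℝ a h) h :=
    (ha.differentiable (by norm_num) h).hasFDerivAt
  have := ha0 h
  exact (h1.add_const ε).rpow_const (Or.inl (by positivity))

lemma K0_d {ε : ℝ} (hε : 0 < ε) (h : E) : HasFDerivAt (K0 a s ε) (K1 a s ε h) h :=
  rp_d ha ha0 hε s h

lemma K1_d {ε : ℝ} (hε : 0 < ε) (h : E) : HasFDerivAt (K1 a s ε) (K2 a s ε h) h := by
  have h1 := (rp_d ha ha0 hε (s - 1) h).const_mul s
  have h2 : HasFDerivAt (fderiv ℝ a) (fderiv ℝ (fderiv ℝ a) h) h :=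
    ((Da_cd ha ha0).differentiable (by norm_num) h).hasFDerivAt
  have h3 := h1.smul h2
  refine h3.congr_fderiv ?_
  unfold K2
  refine ContinuousLinearMap.ext fun x => ContinuousLinearMap.ext fun y => ?_
  simp only [FunLike.coe_add, Pi.add_apply]
  congr 1
  simp only [FunLike.coe_smul, Pi.smul_apply, ContinuousLinearMap.smulRight_apply, smul_eq_mul]
  rw [show s - 1 - 1 = s - 2 by ring]
  ring

lemma K0_c {ε : ℝ} (hε : 0 < ε) : Continuous (K0 a s ε) := rp_c ha ha0 hε s
lemma K1_c {ε : ℝ} (hε : 0 < ε) : Continuous (K1 a s ε) :=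
  (continuous_const.mul (rp_c ha ha0 hε _)).smul (Da_c ha ha0)
lemma K2_c {ε : ℝ} (hε : 0 < ε) : Continuous (K2 a s ε) := by
  have h1 := rp_c ha ha0 hε (s - 1)
  have h2 := rp_c ha ha0 hε (s - 2)
  have h3 := Da_c ha ha0
  have h4 := D2a_c ha ha0
  unfold K2
  exact ((continuous_const.mul h1).smul h4).add ((continuous_const.mul h2).smul (by fun_prop))

lemma rp_lim {h : E} (hh : 0 < a h) (r : ℝ) :
    Tendsto (fun n : ℕ => (a h + 1 / ((n : ℝ) + 1)) ^ r) atTop (𝓝 ((a h + 0) ^ r)) := by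
  refine Tendsto.rpow_const ?_ (Or.inl (by simpa using hh.ne'))
  exact tendsto_const_nhds.add tendsto_one_div_add_atTop_nhds_zero_nat

lemma rp_bd {x A ε : ℝ} (hx : 0 < x) (hA : x ≤ A) (h0 : 0 < ε) (h1 : ε ≤ 1) (r : ℝ) :
    (x + ε) ^ r ≤ x ^ r + (A + 1) ^ r := by
  have hA0 : 0 < A + 1 := by linarith
  rcases le_total 0 r with hr | hr
  · have : (x + ε) ^ r ≤ (A + 1) ^ r := Real.rpow_le_rpow (by linarith) (by linarith) hr
    have := Real.rpow_nonneg hx.le r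
    linarith
  · have : (x + ε) ^ r ≤ x ^ r := Real.rpow_le_rpow_of_nonpos hx (by linarith) hr
    have := Real.rpow_nonneg hA0.le r
    linarith

/-- The generic theorem. -/
lemma gen_main (b : Dat E) {ρ : E → ℝ} (hρc : Continuous ρ) (hρs : HasCompactSupport ρ)
    (hs : 0 < s) (hpos : ∀ᵐ h : E, 0 < a h)
    (hDa : ∀ R, ∃ C, ∀ h ∈ closedBall (0 : E) R, ‖fderiv ℝ a h‖ ^ 2 ≤ C * a h)
    (hint : ∀ R, IntegrableOn (fun h => a h ^ (s - 1)) (closedBall 0 R))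
    {F : E → ℝ} (hF : ∀ g, F g = ∫ g', ρ g' * a (b.L g' g) ^ s) :
    ContDiff ℝ 2 F ∧ ∃ (F1 : E → E →L[ℝ] ℝ) (F2 : E → E →L[ℝ] E →L[ℝ] ℝ),
      (∀ g, HasFDerivAt F (F1 g) g) ∧ (∀ g, HasFDerivAt F1 (F2 g) g) ∧
      ∀ g x y, Integrable (fun g' => ρ g' * K2 a s 0 (b.L g' g) (b.l g' x) (b.l g' y)) ∧
      F2 g x y = ∫ g', ρ g' * K2 a s 0 (b.L g' g) (b.l g' x) (b.l g' y) := by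
  have hε : ∀ n : ℕ, (0 : ℝ) < 1 / ((n : ℝ) + 1) := fun n => Nat.one_div_pos_of_nat
  have hε1 : ∀ n : ℕ, 1 / ((n : ℝ) + 1) ≤ 1 := fun n => by
    rw [div_le_one (by positivity)]
    have : (0 : ℝ) ≤ n := Nat.cast_nonneg n
    linarith
  have hbd : ∀ R, ∃ A C1 C2 C3, 0 ≤ A ∧ 0 ≤ C1 ∧ 0 ≤ C2 ∧ 0 ≤ C3 ∧ ∀ h ∈ closedBall (0 : E) R,
      a h ≤ A ∧ ‖fderiv ℝ a h‖ ≤ C1 ∧ ‖fderiv ℝ (fderiv ℝ a) h‖ ≤ C2 ∧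
      ‖fderiv ℝ a h‖ ^ 2 ≤ C3 * a h := by
    intro R
    have : ProperSpace E := FiniteDimensional.proper ℝ E
    obtain ⟨A, hA⟩ := (isCompact_closedBall (0 : E) R).exists_bound_of_continuousOn
      ha.continuous.continuousOn
    obtain ⟨C1, h1⟩ := (isCompact_closedBall (0 : E) R).exists_bound_of_continuousOn
      (Da_c ha ha0).continuousOn
    obtain ⟨C2, h2⟩ := (isCompact_closedBall (0 : E) R).exists_bound_of_continuousOn
      (D2a_c ha ha0).continuousOn
    obtain ⟨C3, h3⟩ := hDa R
    refine ⟨|A|, |C1|, |C2|, |C3|, abs_nonneg _, abs_nonneg _, abs_nonneg _, abs_nonneg _,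
      fun h hh => ⟨(le_abs_self _).trans ((hA h hh).trans (le_abs_self _)),
      (h1 h hh).trans (le_abs_self _), (h2 h hh).trans (le_abs_self _), (h3 h hh).trans ?_⟩⟩
    gcongr
    · exact ha0 h
    · exact le_abs_self _
  have hconst : ∀ R (c : ℝ), IntegrableOn (fun _ : E => c) (closedBall 0 R) := fun R c => by
    have : ProperSpace E := FiniteDimensional.proper ℝ E
    exact continuousOn_const.integrableOn_compact (isCompact_closedBall _ _)
  have hms : ∀ R, MeasurableSet (closedBall (0 : E) R) :=
    fun R => isClosed_closedBall.measurableSet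
  have l0 : L1c (fun n : ℕ => K0 a s (1 / ((n : ℝ) + 1))) (K0 a s 0) := by
    refine L1c_of_dom (fun n => K0_c s ha ha0 (hε n)) ?_ ?_
    · filter_upwards [hpos] with h hh
      exact rp_lim ha ha0 hh s
    · intro R
      obtain ⟨A, C1, C2, C3, hA, -, -, -, H⟩ := hbd R
      refine ⟨fun _ => (A + 1) ^ s, hconst _ _, fun n => ?_⟩
      filter_upwards [ae_restrict_mem (hms R)] with h hh
      have h0 := ha0 h
      have h1 := hε n
      have h2 := hε1 n
      have h3 := (H h hh).1
      rw [K0, Real.norm_of_nonneg (Real.rpow_nonneg (by linarith) _)]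
      exact Real.rpow_le_rpow (by linarith) (by linarith) hs.le
  have l1 : L1c (fun n : ℕ => K1 a s (1 / ((n : ℝ) + 1))) (K1 a s 0) := by
    refine L1c_of_dom (fun n => K1_c s ha ha0 (hε n)) ?_ ?_
    · filter_upwards [hpos] with h hh
      exact ((rp_lim ha ha0 hh (s - 1)).const_mul s).smul_const _
    · intro R
      obtain ⟨A, C1, C2, C3, hA, hC1, -, -, H⟩ := hbd R
      refine ⟨fun h => (s * (a h ^ (s - 1) + (A + 1) ^ (s - 1))) * C1,
        (((hint R).add (hconst R _)).const_mul s).mul_const C1, fun n => ?_⟩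
      filter_upwards [ae_restrict_mem (hms R), ae_restrict_of_ae hpos] with h hh hp
      have h3 := H h hh
      have hb := rp_bd ha ha0 hp h3.1 (hε n) (hε1 n) (s - 1)
      have hnn : 0 ≤ (a h + 1 / ((n : ℝ) + 1)) ^ (s - 1) :=
        Real.rpow_nonneg (by have := hε n; linarith) _
      rw [K1, norm_smul, Real.norm_of_nonneg (by positivity)]
      gcongr
      exact h3.2.1
  have l2 : L1c (fun n : ℕ => K2 a s (1 / ((n : ℝ) + 1))) (K2 a s 0) := by
    refine L1c_of_dom (fun n => K2_c s ha ha0 (hε n)) ?_ ?_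
    · filter_upwards [hpos] with h hh
      exact (((rp_lim ha ha0 hh (s - 1)).const_mul s).smul_const _).add
        (((rp_lim ha ha0 hh (s - 2)).const_mul (s * (s - 1))).smul_const _)
    · intro R
      obtain ⟨A, C1, C2, C3, hA, hC1, hC2, hC3, H⟩ := hbd R
      refine ⟨fun h => (s * (a h ^ (s - 1) + (A + 1) ^ (s - 1))) * C2 +
          (a h ^ (s - 1) + (A + 1) ^ (s - 1)) * (|s * (s - 1)| * C3),
        ((((hint R).add (hconst R _)).const_mul s).mul_const C2).add
          (((hint R).add (hconst R _)).mul_const _), fun n => ?_⟩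
      filter_upwards [ae_restrict_mem (hms R), ae_restrict_of_ae hpos] with h hh hp
      have h3 := H h hh
      have hb := rp_bd ha ha0 hp h3.1 (hε n) (hε1 n) (s - 1)
      have hp' : 0 < a h + 1 / ((n : ℝ) + 1) := by have := hε n; linarith
      have hnn : 0 ≤ (a h + 1 / ((n : ℝ) + 1)) ^ (s - 1) := Real.rpow_nonneg hp'.le _
      have hnn2 : 0 ≤ (a h + 1 / ((n : ℝ) + 1)) ^ (s - 2) := Real.rpow_nonneg hp'.le _
      rw [K2]
      refine (norm_add_le _ _).trans (add_le_add ?_ ?_)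
      · rw [norm_smul, Real.norm_of_nonneg (by positivity)]
        gcongr
        exact h3.2.2.1
      · rw [norm_smul, ContinuousLinearMap.norm_smulRight_apply, norm_mul,
          Real.norm_of_nonneg hnn2, Real.norm_eq_abs]
        have e1 : (a h + 1 / ((n : ℝ) + 1)) ^ (s - 1) =
            (a h + 1 / ((n : ℝ) + 1)) ^ (s - 2) * (a h + 1 / ((n : ℝ) + 1)) := by
          rw [← Real.rpow_add_one hp'.ne']; congr 1; ring
        have e2 : ‖fderiv ℝ a h‖ * ‖fderiv ℝ a h‖ ≤ C3 * (a h + 1 / ((n : ℝ) + 1)) := by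
          rw [← sq]
          refine h3.2.2.2.trans ?_
          gcongr
          have := hε n; linarith
        calc _ ≤ |s * (s - 1)| * (a h + 1 / ((n : ℝ) + 1)) ^ (s - 2) *
              (C3 * (a h + 1 / ((n : ℝ) + 1))) := by gcongr
          _ = (a h + 1 / ((n : ℝ) + 1)) ^ (s - 1) * (|s * (s - 1)| * C3) := by rw [e1]; ring
          _ ≤ _ := by gcongr
  obtain ⟨r1, r2, r3, r4⟩ := cv_main b hρc hρs l0 l1 l2
    (fun n => K0_d s ha ha0 (hε n)) (fun n => K1_d s ha ha0 (hε n))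
  have hFe : F = cv b (T0 ρ) (K0 a s 0) := by
    funext g
    rw [hF]
    simp [cv, T0, K0]
  rw [← hFe] at r1
  refine ⟨?_, _, _, r1, r2, r4⟩
  have : (2 : WithTop ℕ∞) = ((1 : ℕ) : WithTop ℕ∞) + 1 := by norm_num
  rw [this, contDiff_succ_iff_hasFDerivAt]
  refine ⟨_, ?_, r1⟩
  rw [Nat.cast_one, contDiff_one_iff_hasFDerivAt]
  exact ⟨_, r3, r2⟩
end Ker

section Conc
open Filter Topology Metric
set_option maxSynthPendingDepth 3
set_option linter.unusedSectionVars false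

variable {V₁ V₂ : Type*} [NormedAddCommGroup V₁] [InnerProductSpace ℝ V₁]
  [FiniteDimensional ℝ V₁] [NormedAddCommGroup V₂] [InnerProductSpace ℝ V₂]
  [FiniteDimensional ℝ V₂]

lemma aF_eq : (aF : V₁ × V₂ → ℝ) = fun h => (‖h.1‖ ^ 2) ^ 2 + 16 * ‖h.2‖ ^ 2 := rfl

lemma aF_cd : ContDiff ℝ 2 (aF : V₁ × V₂ → ℝ) := by
  rw [aF_eq]
  exact ((contDiff_fst.norm_sq ℝ).pow 2).add (contDiff_const.mul (contDiff_snd.norm_sq ℝ))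

lemma aF_nonneg (h : V₁ × V₂) : 0 ≤ aF h := by
  rw [aF_eq]; positivity

lemma aF_pos {h : V₁ × V₂} (hh : h ≠ 0) : 0 < aF h := by
  rw [aF_eq]
  by_cases h1 : h.1 = 0
  · have h2 : h.2 ≠ 0 := fun h2 => hh (Prod.ext h1 h2)
    have := norm_pos_iff.2 h2
    positivity
  · have := norm_pos_iff.2 h1
    positivity

lemma Da_eq (h x : V₁ × V₂) :
    fderiv ℝ (aF : V₁ × V₂ → ℝ) h x = 4 * ‖h.1‖ ^ 2 * ⟪h.1, x.1⟫ + 32 * ⟪h.2, x.2⟫ := by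
  have h1 : HasFDerivAt (fun h : V₁ × V₂ => h.1) (ContinuousLinearMap.fst ℝ V₁ V₂) h :=
    hasFDerivAt_fst
  have h2 : HasFDerivAt (fun h : V₁ × V₂ => h.2) (ContinuousLinearMap.snd ℝ V₁ V₂) h :=
    hasFDerivAt_snd
  have h3 := (h1.norm_sq.pow 2).add (h2.norm_sq.const_mul 16)
  rw [aF_eq]
  erw [h3.fderiv]
  simp
  ring

lemma D2a_eq (h x y : V₁ × V₂) :
    fderiv ℝ (fderiv ℝ (aF : V₁ × V₂ → ℝ)) h x y =
      8 * ⟪h.1, x.1⟫ * ⟪h.1, y.1⟫ + 4 * ‖h.1‖ ^ 2 * ⟪x.1, y.1⟫ + 32 * ⟪x.2, y.2⟫ := by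
  have hd : HasFDerivAt (fderiv ℝ (aF : V₁ × V₂ → ℝ)) (fderiv ℝ (fderiv ℝ aF) h) h :=
    (((aF_cd (V₁ := V₁) (V₂ := V₂)).fderiv_right (m := 1)
      (by norm_num)).differentiable (by norm_num) h).hasFDerivAt
  have hd' := hd.clm_apply (hasFDerivAt_const y h)
  have h1 : HasFDerivAt (fun h : V₁ × V₂ => h.1) (ContinuousLinearMap.fst ℝ V₁ V₂) h :=
    hasFDerivAt_fst
  have h2 : HasFDerivAt (fun h : V₁ × V₂ => h.2) (ContinuousLinearMap.snd ℝ V₁ V₂) h :=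
    hasFDerivAt_snd
  have h3 := ((h1.norm_sq.const_mul 4).mul (h1.inner ℝ (hasFDerivAt_const y.1 h))).add
    ((h2.inner ℝ (hasFDerivAt_const y.2 h)).const_mul 32)
  have h4 : (fun h : V₁ × V₂ => fderiv ℝ (aF : V₁ × V₂ → ℝ) h y) = fun h : V₁ × V₂ =>
      4 * ‖h.1‖ ^ 2 * ⟪h.1, y.1⟫ + 32 * ⟪h.2, y.2⟫ := funext fun h => Da_eq h y
  rw [h4] at hd'
  have h5 := congrArg (fun L => L x) (hd'.unique h3)
  simp at h5
  rw [h5]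
  ring

lemma Da_bd (R : ℝ) : ∃ C, ∀ h ∈ closedBall (0 : V₁ × V₂) R,
    ‖fderiv ℝ (aF : V₁ × V₂ → ℝ) h‖ ^ 2 ≤ C * aF h := by
  refine ⟨32 * R ^ 2 + 128, fun h hh => ?_⟩
  rw [mem_closedBall, dist_zero_right] at hh
  have hz : ‖h.1‖ ≤ R := (norm_fst_le h).trans hh
  have h1 : ‖fderiv ℝ (aF : V₁ × V₂ → ℝ) h‖ ≤ 4 * ‖h.1‖ ^ 3 + 32 * ‖h.2‖ := by
    refine ContinuousLinearMap.opNorm_le_bound _ (by positivity) fun x => ?_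
    rw [Da_eq]
    have e1 := abs_real_inner_le_norm h.1 x.1
    have e2 := abs_real_inner_le_norm h.2 x.2
    have e3 := norm_fst_le x
    have e4 := norm_snd_le x
    calc _ ≤ ‖4 * ‖h.1‖ ^ 2 * ⟪h.1, x.1⟫‖ + ‖32 * ⟪h.2, x.2⟫‖ := norm_add_le _ _
      _ = 4 * ‖h.1‖ ^ 2 * |⟪h.1, x.1⟫| + 32 * |⟪h.2, x.2⟫| := by
          simp [abs_mul]
      _ ≤ 4 * ‖h.1‖ ^ 2 * (‖h.1‖ * ‖x‖) + 32 * (‖h.2‖ * ‖x‖) := by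
          gcongr
          · exact e1.trans (by gcongr)
          · exact e2.trans (by gcongr)
      _ = _ := by ring
  have h2 : ‖h.1‖ ^ 2 ≤ R ^ 2 := by gcongr
  have haf : aF h = (‖h.1‖ ^ 2) ^ 2 + 16 * ‖h.2‖ ^ 2 := rfl
  rw [haf]
  have h3 : ‖fderiv ℝ (aF : V₁ × V₂ → ℝ) h‖ ^ 2 ≤ (4 * ‖h.1‖ ^ 3 + 32 * ‖h.2‖) ^ 2 := by gcongr
  have h4 : ‖h.1‖ ^ 2 * (‖h.1‖ ^ 2) ^ 2 ≤ R ^ 2 * (‖h.1‖ ^ 2) ^ 2 := by gcongr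
  have h5 := sq_nonneg (4 * ‖h.1‖ ^ 3 - 32 * ‖h.2‖)
  have h6 : 0 ≤ R ^ 2 * ‖h.2‖ ^ 2 := by positivity
  have h7 : 0 ≤ (‖h.1‖ ^ 2) ^ 2 := by positivity
  nlinarith

section meas
variable [MeasurableSpace V₁] [BorelSpace V₁] [MeasurableSpace V₂] [BorelSpace V₂]

lemma norm_li {V : Type*} [NormedAddCommGroup V] [InnerProductSpace ℝ V] [FiniteDimensional ℝ V]
    [MeasurableSpace V] [BorelSpace V] (hd : 1 ≤ Module.finrank ℝ V) {r : ℝ}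
    (hr : r < Module.finrank ℝ V) (R : ℝ) :
    IntegrableOn (fun z : V => ‖z‖ ^ (-r)) (closedBall 0 R) := by
  have h := locallyIntegrable_of_norm_le_rpow (μ := (volume : Measure V)) (C := 1)
    (f := fun z : V => ‖z‖ ^ (-r)) hd hr
    (ae_of_all _ fun z => by rw [Real.norm_of_nonneg (by positivity), one_mul])
    (measurable_norm.pow_const _).aestronglyMeasurable
  exact h.integrableOn_isCompact (isCompact_closedBall _ _)

lemma ae_ne_zero (hd1 : 2 ≤ Module.finrank ℝ V₁) : ∀ᵐ h : V₁ × V₂, h ≠ 0 := by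
  have : Nontrivial V₁ := Module.nontrivial_of_finrank_pos (R := ℝ) (by omega)
  have n1 : ∀ᵐ h : V₁ × V₂, h.1 ≠ 0 :=
    Measure.quasiMeasurePreserving_fst.ae (Measure.ae_ne volume 0)
  filter_upwards [n1] with h hh h0
  exact hh (by rw [h0]; rfl)

lemma aF_li (hd1 : 2 ≤ Module.finrank ℝ V₁) (hd2 : 1 ≤ Module.finrank ℝ V₂) {s : ℝ}
    (hs : 0 < s) (R : ℝ) :
    IntegrableOn (fun h : V₁ × V₂ => aF h ^ (s - 1)) (closedBall 0 R) := by
  have : Nontrivial V₁ := Module.nontrivial_of_finrank_pos (R := ℝ) (by omega)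
  have : Nontrivial V₂ := Module.nontrivial_of_finrank_pos (R := ℝ) (by omega)
  rcases le_or_gt 1 s with h1 | h1
  · refine ContinuousOn.integrableOn_compact (isCompact_closedBall _ _) ?_
    exact ((aF_cd (V₁ := V₁) (V₂ := V₂)).continuous.rpow_const
      fun h => Or.inr (by linarith)).continuousOn
  · have i1 := norm_li (V := V₁) (r := 2 * (1 - s)) (by omega)
      (by have : (2 : ℝ) ≤ Module.finrank ℝ V₁ := by exact_mod_cast hd1
          linarith) R
    have i2 := norm_li (V := V₂) (r := 1 - s) (by omega)
      (by have : (1 : ℝ) ≤ Module.finrank ℝ V₂ := by exact_mod_cast hd2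
          linarith) R
    have i3 := i1.mul_prod i2
    rw [Measure.prod_restrict, closedBall_prod_same] at i3
    have i3' : IntegrableOn (fun z : V₁ × V₂ =>
      ‖z.1‖ ^ (-(2 * (1 - s))) * ‖z.2‖ ^ (-(1 - s))) (closedBall 0 R) := i3
    refine Integrable.mono' i3' ?_ ?_
    · exact ((aF_cd (V₁ := V₁) (V₂ := V₂)).continuous.measurable.pow_const
        _).aestronglyMeasurable
    · have n1 : ∀ᵐ h : V₁ × V₂, h.1 ≠ 0 :=
        Measure.quasiMeasurePreserving_fst.ae (Measure.ae_ne volume 0)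
      have n2 : ∀ᵐ h : V₁ × V₂, h.2 ≠ 0 :=
        Measure.quasiMeasurePreserving_snd.ae (Measure.ae_ne volume 0)
      filter_upwards [ae_restrict_of_ae n1, ae_restrict_of_ae n2] with h h1' h2'
      have p1 := norm_pos_iff.2 h1'
      have p2 := norm_pos_iff.2 h2'
      rw [Real.norm_of_nonneg (Real.rpow_nonneg (aF_nonneg h) _)]
      have e : ‖h.1‖ ^ (-(2 * (1 - s))) * ‖h.2‖ ^ (-(1 - s)) =
          (‖h.1‖ ^ 2 * ‖h.2‖) ^ (s - 1) := by
        rw [Real.mul_rpow (by positivity) (by positivity), ← Real.rpow_natCast ‖h.1‖ 2,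
          ← Real.rpow_mul (by positivity)]
        congr 2
        · push_cast; ring
        · ring
      rw [e]
      refine Real.rpow_le_rpow_of_nonpos (by positivity) ?_ (by linarith)
      rw [aF_eq]
      nlinarith [sq_nonneg (‖h.1‖ ^ 2 - ‖h.2‖), sq_nonneg (‖h.1‖ ^ 2), sq_nonneg ‖h.2‖]

/-- concrete data -/
noncomputable def dat (b : V₁ →ₗ[ℝ] V₁ →ₗ[ℝ] V₂) : Dat (V₁ × V₂) where
  L := gL b
  l := ell b
  Lcont := gL_cont b
  lcont := ell_cont b
  der := gL_hasFDerivAt b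
  mp := gL_mp b
  emb := gL_emb b
end meas

/-- horizontal lift -/
noncomputable def hl (b : V₁ →ₗ[ℝ] V₁ →ₗ[ℝ] V₂) (z v : V₁) : V₁ × V₂ := (v, (2⁻¹ : ℝ) • b z v)

lemma ell_hl (b : V₁ →ₗ[ℝ] V₁ →ₗ[ℝ] V₂) (g' g : V₁ × V₂) (v : V₁) :
    ell b g' (hl b g.1 v) = hl b (gL b g' g).1 v := by
  rw [ell_apply]
  simp only [hl, gL, gmul, ginv, map_add, map_neg]
  ext
  · rfl
  · simp; abel

section pw
variable (b : V₁ →ₗ[ℝ] V₁ →ₗ[ℝ] V₂) (hskew : ∀ z z' : V₁, b z z' = - b z' z)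
    (J : V₂ → V₁ →ₗ[ℝ] V₁) (hJ : ∀ (t : V₂) (z z' : V₁), ⟪J t z, z'⟫ = ⟪b z z', t⟫)
    (hH : ∀ (t : V₂) (z : V₁), ‖J t z‖ = ‖t‖ * ‖z‖)
include hskew hJ hH

lemma b_self (z : V₁) : b z z = 0 := by
  have := hskew z z
  have h2 : (2 : ℝ) • b z z = 0 := by
    rw [two_smul]
    exact eq_neg_iff_add_eq_zero.1 this
  exact (smul_eq_zero.1 h2).resolve_left two_ne_zero

lemma dim_two (h1 : 1 ≤ Module.finrank ℝ V₁) (h2 : 1 ≤ Module.finrank ℝ V₂) :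
    2 ≤ Module.finrank ℝ V₁ := by
  by_contra hlt
  have hd : Module.finrank ℝ V₁ = 1 := by omega
  have : Nontrivial V₂ := Module.nontrivial_of_finrank_pos (R := ℝ) (by omega)
  obtain ⟨t, ht⟩ := exists_ne (0 : V₂)
  obtain ⟨z, hz, hspan⟩ := finrank_eq_one_iff'.1 hd
  have h0 : J t z = 0 := by
    rw [← inner_self_eq_zero (𝕜 := ℝ), hJ]
    obtain ⟨c, hc⟩ := hspan (J t z)
    rw [← hc, map_smul, b_self b hskew J hJ hH]
    simp
  have := hH t z
  rw [h0, norm_zero] at this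
  have a1 := norm_pos_iff.2 ht
  have a2 := norm_pos_iff.2 hz
  have : 0 < ‖t‖ * ‖z‖ := by positivity
  linarith

lemma Ag_inner (h : V₁ × V₂) (v : V₁) :
    ⟪Ag J h, v⟫ = ‖h.1‖ ^ 2 * ⟪h.1, v⟫ + 4 * ⟪h.2, b h.1 v⟫ := by
  rw [Ag, inner_add_left, real_inner_smul_left, real_inner_smul_left, hJ, real_inner_comm h.2]

lemma Ag_norm (h : V₁ × V₂) : ‖Ag J h‖ ^ 2 = ‖h.1‖ ^ 2 * aF h := by
  have h0 : ⟪J h.2 h.1, h.1⟫ = 0 := by rw [hJ, b_self b hskew J hJ hH]; simp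
  rw [Ag, norm_add_sq_real, norm_smul, norm_smul, real_inner_smul_left, real_inner_smul_right,
    real_inner_comm, h0, hH, aF_eq]
  simp
  ring

lemma sum_b (z : V₁) :
    ∑ i, ‖b z (stdOrthonormalBasis ℝ V₁ i)‖ ^ 2 = Module.finrank ℝ V₂ * ‖z‖ ^ 2 := by
  have h1 : ∀ v, ‖b z v‖ ^ 2 = ∑ j, ⟪J (stdOrthonormalBasis ℝ V₂ j) z, v⟫ ^ 2 := by
    intro v
    rw [← (stdOrthonormalBasis ℝ V₂).sum_sq_inner_right (b z v)]
    refine Finset.sum_congr rfl fun j _ => ?_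
    rw [hJ, real_inner_comm]
  simp_rw [h1]
  rw [Finset.sum_comm]
  have h2 : ∀ j, ∑ i, ⟪J (stdOrthonormalBasis ℝ V₂ j) z, stdOrthonormalBasis ℝ V₁ i⟫ ^ 2 =
      ‖z‖ ^ 2 := by
    intro j
    rw [(stdOrthonormalBasis ℝ V₁).sum_sq_inner_left, hH]
    simp
  simp [h2]

lemma K2_hl (s : ℝ) {h : V₁ × V₂} (hz : h.1 ≠ 0) (v : V₁) :
    K2 aF s 0 h (hl b h.1 v) (hl b h.1 v) = s * aF h ^ (s - 1) *
      (8 * ⟪h.1, v⟫ ^ 2 + 4 * ‖h.1‖ ^ 2 * ‖v‖ ^ 2 + 8 * ‖b h.1 v‖ ^ 2 +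
        16 * (s - 1) * (⟪Ag J h, v⟫ ^ 2 / aF h)) := by
  have hp : 0 < aF h := aF_pos (fun h0 => hz (by rw [h0]; rfl))
  have e1 : aF h ^ (s - 1) = aF h ^ (s - 2) * aF h := by
    rw [← Real.rpow_add_one hp.ne']; congr 1; ring
  have e2 : fderiv ℝ (aF : V₁ × V₂ → ℝ) h (hl b h.1 v) = 4 * ⟪Ag J h, v⟫ := by
    rw [Da_eq, Ag_inner b hskew J hJ hH]
    simp only [hl, real_inner_smul_right]
    ring
  have e3 : fderiv ℝ (fderiv ℝ (aF : V₁ × V₂ → ℝ)) h (hl b h.1 v) (hl b h.1 v) =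
      8 * ⟪h.1, v⟫ ^ 2 + 4 * ‖h.1‖ ^ 2 * ‖v‖ ^ 2 + 8 * ‖b h.1 v‖ ^ 2 := by
    rw [D2a_eq]
    simp only [hl, real_inner_smul_right, real_inner_smul_left]
    rw [real_inner_self_eq_norm_sq, real_inner_self_eq_norm_sq]
    ring
  have e4 : K2 aF s 0 h (hl b h.1 v) (hl b h.1 v) =
      (s * (aF h + 0) ^ (s - 1)) * fderiv ℝ (fderiv ℝ (aF : V₁ × V₂ → ℝ)) h (hl b h.1 v) (hl b h.1 v) +
      (s * (s - 1) * (aF h + 0) ^ (s - 2)) * (fderiv ℝ (aF : V₁ × V₂ → ℝ) h (hl b h.1 v) *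
        fderiv ℝ (aF : V₁ × V₂ → ℝ) h (hl b h.1 v)) := by
    simp [K2]
  rw [e4, e3, e2, add_zero, e1]
  field_simp
  ring

lemma K2_hl0 (s : ℝ) {h : V₁ × V₂} (hz : h.1 = 0) (v : V₁) :
    K2 aF s 0 h (hl b h.1 v) (hl b h.1 v) = 0 := by
  simp [K2, D2a_eq, Da_eq, hl, hz]

lemma pw_ineq {s p : ℝ} (hs : 0 < s) (hm : 2 ≤ Module.finrank ℝ V₁)
    (hp : (Module.finrank ℝ V₁ : ℝ) + 2 * Module.finrank ℝ V₂ < p)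
    (hsp : p - ((Module.finrank ℝ V₁ : ℝ) + 2 * Module.finrank ℝ V₂) ≤ 4 * s * (p - 1))
    (h : V₁ × V₂) (ξ : V₁) :
    0 ≤ ‖ξ‖ ^ 2 * ∑ i, K2 aF s 0 h (hl b h.1 (stdOrthonormalBasis ℝ V₁ i))
        (hl b h.1 (stdOrthonormalBasis ℝ V₁ i)) +
      (p - 2) * K2 aF s 0 h (hl b h.1 ξ) (hl b h.1 ξ) := by
  by_cases hz : h.1 = 0
  · simp [K2_hl0 b hskew J hJ hH s hz]
  have ha : 0 < aF h := aF_pos (fun h0 => hz (by rw [h0]; rfl))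
  simp_rw [K2_hl b hskew J hJ hH s hz]
  rw [← Finset.mul_sum]
  have hsum : ∑ i, (8 * ⟪h.1, stdOrthonormalBasis ℝ V₁ i⟫ ^ 2 +
      4 * ‖h.1‖ ^ 2 * ‖stdOrthonormalBasis ℝ V₁ i‖ ^ 2 + 8 * ‖b h.1 (stdOrthonormalBasis ℝ V₁ i)‖ ^ 2 +
        16 * (s - 1) * (⟪Ag J h, stdOrthonormalBasis ℝ V₁ i⟫ ^ 2 / aF h)) =
      ‖h.1‖ ^ 2 * (8 + 4 * Module.finrank ℝ V₁ + 8 * Module.finrank ℝ V₂ + 16 * (s - 1)) := by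
    simp_rw [Finset.sum_add_distrib, ← Finset.mul_sum, ← Finset.sum_div]
    rw [sum_b b hskew J hJ hH, (stdOrthonormalBasis ℝ V₁).sum_sq_inner_left,
      (stdOrthonormalBasis ℝ V₁).sum_sq_inner_left, Ag_norm b hskew J hJ hH]
    simp
    field_simp
  rw [hsum]
  set w := ⟪Ag J h, ξ⟫ ^ 2 / aF h with hw
  have w0 : 0 ≤ w := by positivity
  have w1 : w ≤ ‖h.1‖ ^ 2 * ‖ξ‖ ^ 2 := by
    rw [hw, div_le_iff₀ ha]
    calc ⟪Ag J h, ξ⟫ ^ 2 ≤ (‖Ag J h‖ * ‖ξ‖) ^ 2 := by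
          rw [← sq_abs]; gcongr; exact abs_real_inner_le_norm _ _
      _ = _ := by rw [mul_pow, Ag_norm b hskew J hJ hH]; ring
  have w2 : w ≤ ⟪h.1, ξ⟫ ^ 2 + ‖b h.1 ξ‖ ^ 2 := by
    rw [hw, div_le_iff₀ ha, Ag_inner b hskew J hJ hH, aF_eq]
    have c1 := abs_real_inner_le_norm h.2 (b h.1 ξ)
    set x := ⟪h.1, ξ⟫
    set y := ‖b h.1 ξ‖
    set q := ⟪h.2, b h.1 ξ⟫
    have c2 : |‖h.1‖ ^ 2 * x + 4 * q| ≤ ‖h.1‖ ^ 2 * |x| + 4 * (‖h.2‖ * y) := by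
      refine (abs_add_le _ _).trans ?_
      rw [abs_mul, abs_mul, abs_of_nonneg (show (0 : ℝ) ≤ ‖h.1‖ ^ 2 by positivity),
        abs_of_nonneg (show (0 : ℝ) ≤ 4 by norm_num)]
      gcongr
    have c3 : (‖h.1‖ ^ 2 * x + 4 * q) ^ 2 ≤ (‖h.1‖ ^ 2 * |x| + 4 * (‖h.2‖ * y)) ^ 2 := by
      rw [← sq_abs]; gcongr
    refine c3.trans ?_
    rw [← sq_abs x]
    nlinarith [sq_nonneg (‖h.1‖ ^ 2 * y - 4 * ‖h.2‖ * |x|)]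
  have hm' : (2 : ℝ) ≤ Module.finrank ℝ V₁ := by exact_mod_cast hm
  have hk' : (0 : ℝ) ≤ Module.finrank ℝ V₂ := Nat.cast_nonneg _
  set M : ℝ := ((Module.finrank ℝ V₁ : ℕ) : ℝ)
  set k : ℝ := ((Module.finrank ℝ V₂ : ℕ) : ℝ)
  set n := ‖ξ‖ ^ 2
  set ψ := ‖h.1‖ ^ 2
  set X := ⟪h.1, ξ⟫ ^ 2
  set Y := ‖b h.1 ξ‖ ^ 2
  have hn : 0 ≤ n := by positivity
  have hψ : 0 ≤ ψ := by positivity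
  have hc : 0 ≤ s * aF h ^ (s - 1) := by positivity
  have hp2 : 0 ≤ p - 2 := by linarith
  have hnψ : 0 ≤ ψ * n := by positivity
  have key : 0 ≤ n * (ψ * (8 + 4 * M + 8 * k + 16 * (s - 1))) +
      (p - 2) * (8 * X + 4 * ψ * n + 8 * Y + 16 * (s - 1) * w) := by
    have k1 : 4 * ψ * n + (16 * s - 8) * w ≤ 8 * X + 4 * ψ * n + 8 * Y + 16 * (s - 1) * w := by
      linarith
    have k2 := mul_le_mul_of_nonneg_left k1 hp2
    refine le_trans ?_ (add_le_add_right k2 _)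
    rcases le_total 0 (16 * s - 8) with h8 | h8
    · have : 0 ≤ (16 * s - 8) * w := mul_nonneg h8 w0
      have h9 : 0 ≤ 8 + 4 * M + 8 * k + 16 * (s - 1) := by linarith
      have : 0 ≤ 4 * ψ * n + (16 * s - 8) * w := by linarith
      positivity
    · have h9 : (16 * s - 8) * (ψ * n) ≤ (16 * s - 8) * w := mul_le_mul_of_nonpos_left w1 h8
      have h10 := mul_le_mul_of_nonneg_left h9 hp2
      have h11 : 0 ≤ (ψ * n) * (4 * (4 * s * (p - 1) - (p - (M + 2 * k)))) :=
        mul_nonneg hnψ (by linarith)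
      nlinarith
  have := mul_nonneg hc key
  linarith
end pw
end Conc

section Fin
open Filter Topology Metric
set_option maxSynthPendingDepth 3
set_option linter.unusedSectionVars false

variable {V₁ V₂ : Type*} [NormedAddCommGroup V₁] [InnerProductSpace ℝ V₁]
  [FiniteDimensional ℝ V₁] [NormedAddCommGroup V₂] [InnerProductSpace ℝ V₂]
  [FiniteDimensional ℝ V₂]

lemma Xd_eq (b : V₁ →ₗ[ℝ] V₁ →ₗ[ℝ] V₂) {F : V₁ × V₂ → ℝ}
    {F1 : V₁ × V₂ → (V₁ × V₂) →L[ℝ] ℝ} (h1 : ∀ g, HasFDerivAt F (F1 g) g) (v : V₁) (g : V₁ × V₂) :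
    Xd b v F g = F1 g (hl b g.1 v) := by
  rw [Xd, (h1 g).fderiv]; rfl

lemma hl_der (b : V₁ →ₗ[ℝ] V₁ →ₗ[ℝ] V₂) (v : V₁) (g : V₁ × V₂) :
    ∃ D : (V₁ × V₂) →L[ℝ] (V₁ × V₂), HasFDerivAt (fun g : V₁ × V₂ => hl b g.1 v) D g ∧
      ∀ x, D x = (0, (2⁻¹ : ℝ) • b x.1 v) := by
  have h0 : HasFDerivAt (fun g : V₁ × V₂ => (2⁻¹ : ℝ) • (bcl b).flip v g.1)
      ((2⁻¹ : ℝ) • (((bcl b).flip v).comp (ContinuousLinearMap.fst ℝ V₁ V₂))) g :=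
    (((bcl b).flip v).comp (ContinuousLinearMap.fst ℝ V₁ V₂)).hasFDerivAt.const_smul _
  exact ⟨_, (hasFDerivAt_const v g).prodMk h0, fun x => rfl⟩

lemma Xd2_eq (b : V₁ →ₗ[ℝ] V₁ →ₗ[ℝ] V₂) {F : V₁ × V₂ → ℝ}
    {F1 : V₁ × V₂ → (V₁ × V₂) →L[ℝ] ℝ} {F2 : V₁ × V₂ → (V₁ × V₂) →L[ℝ] (V₁ × V₂) →L[ℝ] ℝ}
    (h1 : ∀ g, HasFDerivAt F (F1 g) g)
    (h2 : ∀ g, HasFDerivAt F1 (F2 g) g) (u v : V₁) (g : V₁ × V₂) :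
    Xd b u (Xd b v F) g = F2 g (hl b g.1 u) (hl b g.1 v) + F1 g (0, (2⁻¹ : ℝ) • b u v) := by
  have e : Xd b v F = fun g => F1 g (hl b g.1 v) := funext (Xd_eq b h1 v)
  obtain ⟨D, hD, hD'⟩ := hl_der b v g
  have h3 := (h2 g).clm_apply hD
  rw [e, Xd, h3.fderiv]
  change _ = F2 g (hl b g.1 u) (hl b g.1 v) + _
  rw [ContinuousLinearMap.add_apply, ContinuousLinearMap.comp_apply, hD',
    ContinuousLinearMap.flip_apply, add_comm]
  rfl

/-- horizontal lift, linear -/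
noncomputable def hlL (b : V₁ →ₗ[ℝ] V₁ →ₗ[ℝ] V₂) (z : V₁) : V₁ →ₗ[ℝ] V₁ × V₂ :=
  LinearMap.prod LinearMap.id ((2⁻¹ : ℝ) • b z)

lemma hlL_apply (b : V₁ →ₗ[ℝ] V₁ →ₗ[ℝ] V₂) (z v : V₁) : hlL b z v = hl b z v := rfl

lemma Xgrad_inner (b : V₁ →ₗ[ℝ] V₁ →ₗ[ℝ] V₂) {F : V₁ × V₂ → ℝ}
    {F1 : V₁ × V₂ → (V₁ × V₂) →L[ℝ] ℝ} (h1 : ∀ g, HasFDerivAt F (F1 g) g) (v : V₁) (g : V₁ × V₂) :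
    ⟪Xgrad b F g, v⟫ = F1 g (hl b g.1 v) := by
  rw [Xgrad, InnerProductSpace.toDual_symm_apply, (h1 g).fderiv]
  rfl

lemma hLap_eq (b : V₁ →ₗ[ℝ] V₁ →ₗ[ℝ] V₂) (hb : ∀ z, b z z = 0) {F : V₁ × V₂ → ℝ}
    {F1 : V₁ × V₂ → (V₁ × V₂) →L[ℝ] ℝ} {F2 : V₁ × V₂ → (V₁ × V₂) →L[ℝ] (V₁ × V₂) →L[ℝ] ℝ}
    (h1 : ∀ g, HasFDerivAt F (F1 g) g)
    (h2 : ∀ g, HasFDerivAt F1 (F2 g) g) (g : V₁ × V₂) :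
    hLap b F g = ∑ i, F2 g (hl b g.1 (stdOrthonormalBasis ℝ V₁ i))
      (hl b g.1 (stdOrthonormalBasis ℝ V₁ i)) := by
  refine Finset.sum_congr rfl fun i _ => ?_
  rw [Xd2_eq b h1 h2, hb, smul_zero]
  have : ((0 : V₁), (0 : V₂)) = 0 := rfl
  rw [this, map_zero, add_zero]

lemma hInf_eq (b : V₁ →ₗ[ℝ] V₁ →ₗ[ℝ] V₂) (hskew : ∀ z z' : V₁, b z z' = - b z' z)
    {F : V₁ × V₂ → ℝ}
    {F1 : V₁ × V₂ → (V₁ × V₂) →L[ℝ] ℝ} {F2 : V₁ × V₂ → (V₁ × V₂) →L[ℝ] (V₁ × V₂) →L[ℝ] ℝ}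
    (h1 : ∀ g, HasFDerivAt F (F1 g) g)
    (h2 : ∀ g, HasFDerivAt F1 (F2 g) g) (g : V₁ × V₂) :
    hInfLap b F g = F2 g (hl b g.1 (Xgrad b F g)) (hl b g.1 (Xgrad b F g)) := by
  set ξ := Xgrad b F g with hξ
  set e := stdOrthonormalBasis ℝ V₁ with he
  have hc : ∀ v, Xd b v F g = ⟪v, ξ⟫ := fun v => by
    rw [Xd_eq b h1, ← Xgrad_inner b h1, real_inner_comm]
  have hx : hl b g.1 ξ = ∑ i, ⟪e i, ξ⟫ • hl b g.1 (e i) := by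
    conv_lhs => rw [← e.sum_repr' ξ]
    simp only [← hlL_apply, map_sum, map_smul]
  have hX : ∀ u v, X2sym b u v F g = (F2 g (hl b g.1 u) (hl b g.1 v) +
      F2 g (hl b g.1 v) (hl b g.1 u)) / 2 := by
    intro u v
    rw [X2sym, Xd2_eq b h1 h2, Xd2_eq b h1 h2, hskew u v]
    have : ((0 : V₁), (2⁻¹ : ℝ) • -(b v u)) = -((0 : V₁), (2⁻¹ : ℝ) • (b v u)) := by
      ext <;> simp
    rw [this, map_neg]
    ring
  have hR : F2 g (hl b g.1 ξ) (hl b g.1 ξ) =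
      ∑ i, ∑ j, ⟪e i, ξ⟫ * ⟪e j, ξ⟫ * F2 g (hl b g.1 (e i)) (hl b g.1 (e j)) := by
    rw [hx]
    simp only [map_sum, map_smul, ContinuousLinearMap.sum_apply, ContinuousLinearMap.smul_apply,
      smul_eq_mul, Finset.mul_sum, mul_assoc]
    try rw [Finset.sum_comm]
    refine Finset.sum_congr rfl fun i _ => Finset.sum_congr rfl fun j _ => ?_
    ring
  have hR' : F2 g (hl b g.1 ξ) (hl b g.1 ξ) =
      ∑ i, ∑ j, ⟪e i, ξ⟫ * ⟪e j, ξ⟫ * F2 g (hl b g.1 (e j)) (hl b g.1 (e i)) := by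
    rw [hR, Finset.sum_comm]
    refine Finset.sum_congr rfl fun i _ => Finset.sum_congr rfl fun j _ => ?_
    ring
  have : 2 * hInfLap b F g = F2 g (hl b g.1 ξ) (hl b g.1 ξ) + F2 g (hl b g.1 ξ) (hl b g.1 ξ) := by
    have hL : hInfLap b F g = ∑ i, ∑ j, (F2 g (hl b g.1 (e i)) (hl b g.1 (e j)) +
      F2 g (hl b g.1 (e j)) (hl b g.1 (e i))) / 2 * ⟪e i, ξ⟫ * ⟪e j, ξ⟫ := by
      rw [hInfLap]
      simp only [hX, hc, he]
    rw [hL]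
    nth_rewrite 1 [hR]
    rw [hR', Finset.mul_sum, ← Finset.sum_add_distrib]
    refine Finset.sum_congr rfl fun i _ => ?_
    rw [Finset.mul_sum, ← Finset.sum_add_distrib]
    refine Finset.sum_congr rfl fun j _ => ?_
    ring
  linarith
end Fin

theorem riesz_htype_main_subharmonic {V₁ V₂ : Type*} [NormedAddCommGroup V₁] [InnerProductSpace ℝ V₁]
    [FiniteDimensional ℝ V₁] [NormedAddCommGroup V₂] [InnerProductSpace ℝ V₂]
    [FiniteDimensional ℝ V₂] (m k : ℕ) (hm : 1 ≤ m) (hk : 1 ≤ k)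
    (hdV₁ : Module.finrank ℝ V₁ = m) (hdV₂ : Module.finrank ℝ V₂ = k)
    (b : V₁ →ₗ[ℝ] V₁ →ₗ[ℝ] V₂) (hskew : ∀ z z' : V₁, b z z' = - b z' z)
    (J : V₂ → V₁ →ₗ[ℝ] V₁) (hJ : ∀ (t : V₂) (z z' : V₁), ⟪J t z, z'⟫ = ⟪b z z', t⟫) (hH : ∀ (t : V₂) (z : V₁), ‖J t z‖ = ‖t‖ * ‖z‖) [MeasurableSpace V₁] [BorelSpace V₁] [MeasurableSpace V₂] [BorelSpace V₂]
    (ρ : V₁ × V₂ → ℝ) (hρc : Continuous ρ) (hρ0 : ∀ g, 0 ≤ ρ g)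
    (hρs : HasCompactSupport ρ)
    (p α : ℝ) (hp : (m : ℝ) + 2 * k < p) (hα : (p - ((m : ℝ) + 2 * k)) / (p - 1) ≤ -α)
    (F : V₁ × V₂ → ℝ)
    (hF : ∀ g : V₁ × V₂, F g = ∫ g' : V₁ × V₂, ρ g' * Ng (gmul b (ginv g') g) ^ (-α)) :
    ContDiff ℝ 2 F ∧ ∀ g : V₁ × V₂,
      0 ≤ ‖Xgrad b F g‖ ^ 2 * hLap b F g + (p - 2) * hInfLap b F g := by
  set_option maxSynthPendingDepth 3 in
  have hd1 : 1 ≤ Module.finrank ℝ V₁ := by omega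
  have hd2 : 1 ≤ Module.finrank ℝ V₂ := by omega
  have hdt := dim_two b hskew J hJ hH hd1 hd2
  have hm2 : (2 : ℝ) ≤ m := by rw [hdV₁] at hdt; exact_mod_cast hdt
  have hk0 : (0 : ℝ) ≤ k := Nat.cast_nonneg _
  have hp1 : 0 < p - 1 := by linarith
  have hα' := (div_le_iff₀ hp1).1 hα
  have hαp : 0 < -α := lt_of_lt_of_le (div_pos (by linarith) hp1) hα
  set s : ℝ := -α / 4 with hs
  have hs0 : 0 < s := by positivity
  have hF' : ∀ g, F g = ∫ g', ρ g' * aF ((dat b).L g' g) ^ s := by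
    intro g
    rw [hF g]
    refine integral_congr_ae (Filter.Eventually.of_forall fun g' => ?_)
    change ρ g' * Ng (gmul b (ginv g') g) ^ (-α) = ρ g' * aF (gmul b (ginv g') g) ^ s
    rw [Ng, ← Real.rpow_mul (aF_nonneg _)]
    congr 2
    rw [hs]; ring
  obtain ⟨hC, F1, F2, h1, h2, h3⟩ := gen_main s aF_cd aF_nonneg (dat b) hρc hρs hs0
    ((ae_ne_zero hdt).mono fun h hh => aF_pos hh) Da_bd (aF_li hdt hd2 hs0) hF'
  refine ⟨hC, fun g => ?_⟩
  rw [hLap_eq b (b_self b hskew J hJ hH) h1 h2, hInf_eq b hskew h1 h2]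
  set ξ := Xgrad b F g
  have h4 : ∀ v, Integrable (fun g' => ρ g' * K2 aF s 0 (gL b g' g) (hl b (gL b g' g).1 v)
        (hl b (gL b g' g).1 v)) ∧
      F2 g (hl b g.1 v) (hl b g.1 v) = ∫ g', ρ g' * K2 aF s 0 (gL b g' g)
        (hl b (gL b g' g).1 v) (hl b (gL b g' g).1 v) := by
    intro v
    simp_rw [← ell_hl]
    exact h3 g (hl b g.1 v) (hl b g.1 v)
  simp_rw [fun v => (h4 v).2]
  rw [← integral_finsetSum _ (fun i _ => (h4 _).1), ← integral_const_mul, ← integral_const_mul,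
    ← integral_add ((integrable_finsetSum _ (fun i _ => (h4 _).1)).const_mul _)
      ((h4 _).1.const_mul _)]
  refine integral_nonneg fun g' => ?_
  have h5 := mul_nonneg (hρ0 g') (pw_ineq b hskew J hJ hH (s := s) (p := p) hs0 hdt
    (by rw [hdV₁, hdV₂]; exact hp) (by rw [hdV₁, hdV₂, hs]; linarith) (gL b g' g) ξ)
  refine h5.trans_eq ?_
  change _ = ‖ξ‖ ^ 2 * (∑ i, ρ g' * _) + (p - 2) * (ρ g' * _)
  rw [← Finset.mul_sum]
  ring
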